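/- Let n ≥ 1, n < p < +∞, and γ = p − n. There exists a constant C > 0, depending only on n and p, such that every function u : ℝⁿ → ℝ that is continuously differentiable on ℝⁿ₊ satisfies, for all x ∈ ℝⁿ₊ and all R > 0, (1/|C_R(x)|) ∫_{C_R(x)} |u(x) − u(z)| dz ≤ C · ( ln( 1 + (R/xₙ)^{(p−n)/(p−1)} ) )^{1 − 1/p} · ( ∫_{C_R(x)} ‖Du(z)‖^p zₙ^{p−n} dz )^{1/p}. -/

import Mathlib

open MeasureTheory Real Set
open scoped ENNReal

noncomputable section

/-- The last coordinate `xₙ` of a point of `ℝⁿ`. -/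
def lastCoord (n : ℕ) (x : EuclideanSpace ℝ (Fin n)) : ℝ :=
  if h : 0 < n then x ⟨n - 1, Nat.sub_lt h one_pos⟩ else 0

/-- The open upper half-space `ℝⁿ₊`. -/
def upperHalf (n : ℕ) : Set (EuclideanSpace ℝ (Fin n)) :=
  {z | 0 < lastCoord n z}

/-- The weighted energy `E_γ(u) = ∫_{ℝⁿ₊} ‖Du(z)‖^p zₙ^γ dz`, as a value in `[0, +∞]`. -/
def energy (n : ℕ) (γ p : ℝ) (u : EuclideanSpace ℝ (Fin n) → ℝ) : ℝ≥0∞ :=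
  ∫⁻ z in upperHalf n, ENNReal.ofReal (‖fderiv ℝ u z‖ ^ p * lastCoord n z ^ γ)

/-- The Euclidean norm of the first `n - 1` coordinates of a point of `ℝⁿ`,
i.e. `|x′|` where `x = (x′, xₙ)`. -/
def sideNorm (n : ℕ) (x : EuclideanSpace ℝ (Fin n)) : ℝ :=
  Real.sqrt (∑ i ∈ Finset.univ.filter (fun i : Fin n => (i : ℕ) < n - 1), x i ^ 2)

/-- The upward cone `C_R(x) = {z ∈ ℝⁿ : |z′ − x′| < zₙ − xₙ < R}`. -/
def cone (n : ℕ) (R : ℝ) (x : EuclideanSpace ℝ (Fin n)) : Set (EuclideanSpace ℝ (Fin n)) :=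
  {z | sideNorm n (z - x) < lastCoord n (z - x) ∧ lastCoord n (z - x) < R}


variable {n : ℕ}

lemma lastCoord_of_pos (hn : 1 ≤ n) (x : EuclideanSpace ℝ (Fin n)) :
    lastCoord n x = x ⟨n - 1, Nat.sub_lt hn one_pos⟩ :=
  dif_pos hn

lemma lastCoord_add (x y : EuclideanSpace ℝ (Fin n)) :
    lastCoord n (x + y) = lastCoord n x + lastCoord n y := by
  unfold lastCoord
  split_ifs <;> simp

lemma lastCoord_smul (c : ℝ) (x : EuclideanSpace ℝ (Fin n)) :
    lastCoord n (c • x) = c * lastCoord n x := by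
  unfold lastCoord
  split_ifs <;> simp

@[fun_prop]
lemma continuous_lastCoord : Continuous (lastCoord n) := by
  unfold lastCoord
  split_ifs <;> fun_prop

@[fun_prop]
lemma measurable_lastCoord : Measurable (lastCoord n) :=
  continuous_lastCoord.measurable

@[fun_prop]
lemma continuous_sideNorm : Continuous (sideNorm n) := by
  unfold sideNorm
  fun_prop

lemma sideNorm_nonneg (x : EuclideanSpace ℝ (Fin n)) : 0 ≤ sideNorm n x :=
  Real.sqrt_nonneg _

lemma sideNorm_smul {c : ℝ} (hc : 0 ≤ c) (x : EuclideanSpace ℝ (Fin n)) :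
    sideNorm n (c • x) = c * sideNorm n x := by
  unfold sideNorm
  rw [← Real.sqrt_sq hc, ← Real.sqrt_mul (sq_nonneg c), Finset.mul_sum, Real.sqrt_sq hc]
  simp [mul_pow]

lemma norm_sq_eq_sideNorm_sq_add (hn : 1 ≤ n) (x : EuclideanSpace ℝ (Fin n)) :
    ‖x‖ ^ 2 = sideNorm n x ^ 2 + lastCoord n x ^ 2 := by
  have hfilter : Finset.univ.filter (fun i : Fin n => ¬ (i : ℕ) < n - 1) =
      {⟨n - 1, Nat.sub_lt hn one_pos⟩} := by
    ext i
    simp [Fin.ext_iff]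
    omega
  rw [EuclideanSpace.real_norm_sq_eq, sideNorm,
    Real.sq_sqrt (Finset.sum_nonneg fun i _ => sq_nonneg _), lastCoord_of_pos hn,
    ← Finset.sum_filter_add_sum_filter_not Finset.univ (fun i : Fin n => (i : ℕ) < n - 1),
    hfilter, Finset.sum_singleton]

lemma isOpen_upperHalf : IsOpen (upperHalf n) :=
  isOpen_lt continuous_const continuous_lastCoord

lemma isOpen_cone (R : ℝ) (x : EuclideanSpace ℝ (Fin n)) : IsOpen (cone n R x) :=
  (isOpen_lt (continuous_sideNorm.comp (continuous_id.sub continuous_const))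
    (continuous_lastCoord.comp (continuous_id.sub continuous_const))).inter
    (isOpen_lt (continuous_lastCoord.comp (continuous_id.sub continuous_const)) continuous_const)

lemma mem_cone_zero {R : ℝ} {y : EuclideanSpace ℝ (Fin n)} :
    y ∈ cone n R 0 ↔ sideNorm n y < lastCoord n y ∧ lastCoord n y < R := by
  simp [cone]

lemma lastCoord_pos_of_mem_cone {R : ℝ} {y : EuclideanSpace ℝ (Fin n)} (hy : y ∈ cone n R 0) :
    0 < lastCoord n y :=
  (sideNorm_nonneg y).trans_lt (mem_cone_zero.1 hy).1

lemma add_mem_cone_iff {R : ℝ} {x y : EuclideanSpace ℝ (Fin n)} :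
    x + y ∈ cone n R x ↔ y ∈ cone n R 0 := by
  simp [cone]

lemma smul_mem_cone_iff {t R : ℝ} (ht : 0 < t) {y : EuclideanSpace ℝ (Fin n)} :
    t • y ∈ cone n (t * R) 0 ↔ y ∈ cone n R 0 := by
  simp [mem_cone_zero, sideNorm_smul ht.le, lastCoord_smul, ht]

lemma norm_le_of_mem_cone (hn : 1 ≤ n) {R : ℝ} {y : EuclideanSpace ℝ (Fin n)}
    (hy : y ∈ cone n R 0) : ‖y‖ ≤ 2 * lastCoord n y := by
  have h0 := lastCoord_pos_of_mem_cone hy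
  have h1 := (mem_cone_zero.1 hy).1
  have h2 := sideNorm_nonneg y
  refine (abs_le_of_sq_le_sq' ?_ (by positivity)).2
  rw [norm_sq_eq_sideNorm_sq_add hn]
  nlinarith

lemma cone_zero_subset_ball (hn : 1 ≤ n) (R : ℝ) :
    cone n R 0 ⊆ Metric.ball (0 : EuclideanSpace ℝ (Fin n)) (2 * R) := fun y hy => by
  rw [mem_ball_zero_iff]
  linarith [norm_le_of_mem_cone hn hy, (mem_cone_zero.1 hy).2]

lemma setLIntegral_cone_eq (R : ℝ) (x : EuclideanSpace ℝ (Fin n))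
    (f : EuclideanSpace ℝ (Fin n) → ℝ≥0∞) :
    ∫⁻ z in cone n R x, f z = ∫⁻ y in cone n R 0, f (x + y) := by
  have hpre : (fun y => x + y) ⁻¹' cone n R x = cone n R 0 := by
    ext y
    rw [mem_preimage, add_mem_cone_iff]
  have hmap : Measure.map (fun y => x + y) (volume.restrict (cone n R 0)) =
      volume.restrict (cone n R x) := by
    rw [← hpre, ← (measurableEmbedding_addLeft x).restrict_map, map_add_left_eq_self]
  rw [← hmap, (measurableEmbedding_addLeft x).lintegral_map]

lemma volume_cone_eq (R : ℝ) (x : EuclideanSpace ℝ (Fin n)) :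
    volume (cone n R x) = volume (cone n R 0) := by
  simpa using setLIntegral_cone_eq R x 1

lemma volume_cone_ne_top (hn : 1 ≤ n) (R : ℝ) : volume (cone n R 0) ≠ ∞ :=
  ((measure_mono (cone_zero_subset_ball hn R)).trans_lt measure_ball_lt_top).ne

lemma volume_cone_ne_zero (hn : 1 ≤ n) {R : ℝ} (hR : 0 < R) : volume (cone n R 0) ≠ 0 := by
  refine ((isOpen_cone R 0).measure_pos _
    ⟨EuclideanSpace.single ⟨n - 1, Nat.sub_lt hn one_pos⟩ (R / 2), ?_⟩).ne'
  have h : sideNorm n (EuclideanSpace.single ⟨n - 1, Nat.sub_lt hn one_pos⟩ (R / 2)) = 0 := by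
    rw [sideNorm, Real.sqrt_eq_zero (Finset.sum_nonneg fun i _ => sq_nonneg _)]
    refine Finset.sum_eq_zero fun i hi => ?_
    have : i ≠ ⟨n - 1, Nat.sub_lt hn one_pos⟩ := by
      rintro rfl
      simp at hi
    simp [this]
  rw [mem_cone_zero, h, lastCoord_of_pos hn]
  simp [hR]

lemma setLIntegral_cone_comp_smul {t R : ℝ} (ht : 0 < t)
    (f : EuclideanSpace ℝ (Fin n) → ℝ≥0∞) :
    ∫⁻ y in cone n R 0, f (t • y) =
      ENNReal.ofReal ((t ^ n)⁻¹) * ∫⁻ w in cone n (t * R) 0, f w := by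
  have hemb : MeasurableEmbedding (fun y : EuclideanSpace ℝ (Fin n) => t • y) :=
    (Homeomorph.smulOfNeZero t ht.ne').measurableEmbedding
  have hpre : (fun y : EuclideanSpace ℝ (Fin n) => t • y) ⁻¹' cone n (t * R) 0 = cone n R 0 := by
    ext y
    exact smul_mem_cone_iff ht
  rw [← hpre, ← hemb.lintegral_map, ← hemb.restrict_map, Measure.map_addHaar_smul _ ht.ne',
    Measure.restrict_smul, lintegral_smul_measure, finrank_euclideanSpace_fin,
    abs_of_pos (by positivity), smul_eq_mul]

lemma volume_cone (hn : 1 ≤ n) {R : ℝ} (hR : 0 ≤ R) :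
    volume (cone n R 0) = ENNReal.ofReal (R ^ n) * volume (cone n 1 0) := by
  rcases hR.eq_or_lt with rfl | hR
  · have : cone n 0 0 = ∅ := by
      ext y
      simp only [mem_empty_iff_false, iff_false]
      intro hy
      linarith [lastCoord_pos_of_mem_cone hy, (mem_cone_zero.1 hy).2]
    rw [this, measure_empty, zero_pow (by omega), ENNReal.ofReal_zero, zero_mul]
  · have h := setLIntegral_cone_comp_smul (n := n) (R := 1) hR (fun _ => 1)
    simp only [setLIntegral_one, mul_one] at h
    rw [h, ← mul_assoc, ← ENNReal.ofReal_mul (by positivity),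
      mul_inv_cancel₀ (by positivity), ENNReal.ofReal_one, one_mul]

lemma lintegral_Ioo_pow (hn : 1 ≤ n) {R : ℝ} (hR : 0 ≤ R) :
    ∫⁻ s in Ioo 0 R, ENNReal.ofReal (n * s ^ (n - 1)) = ENNReal.ofReal (R ^ n) := by
  have hint : IntegrableOn (fun s : ℝ => (n : ℝ) * s ^ (n - 1)) (Ioc 0 R) :=
    ((by fun_prop : Continuous fun s : ℝ => (n : ℝ) * s ^ (n - 1)).integrableOn_Ioc)
  rw [setLIntegral_congr Ioo_ae_eq_Ioc, ← ofReal_integral_eq_lintegral_ofReal hint,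
    ← intervalIntegral.integral_of_le hR, intervalIntegral.integral_const_mul, integral_pow]
  · congr 1
    have : (n : ℝ) ≠ 0 := by positivity
    rw [Nat.cast_sub hn, Nat.sub_add_cancel hn, zero_pow (by omega)]
    simp only [sub_add_cancel, sub_zero, Nat.cast_one]
    field_simp
  · filter_upwards [self_mem_ae_restrict measurableSet_Ioc] with s hs
    have := hs.1
    simp only [Pi.zero_apply]
    positivity

lemma setLIntegral_cone_lastCoord (hn : 1 ≤ n) {R : ℝ} (hR : 0 < R) {F : ℝ → ℝ≥0∞}
    (hF : Measurable F) :
    ∫⁻ w in cone n R 0, F (lastCoord n w) =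
      volume (cone n 1 0) * ∫⁻ s in Ioo 0 R, ENNReal.ofReal (n * s ^ (n - 1)) * F s := by
  set A := volume (cone n 1 0)
  have hd : Measurable fun s : ℝ => A * ENNReal.ofReal (n * s ^ (n - 1)) := by fun_prop
  have key : Measure.map (lastCoord n) (volume.restrict (cone n R 0)) =
      (volume.restrict (Ioo 0 R)).withDensity
        (fun s => A * ENNReal.ofReal (n * s ^ (n - 1))) := by
    have : IsFiniteMeasure (volume.restrict (cone n R 0)) :=
      isFiniteMeasure_restrict.2 (volume_cone_ne_top hn R)
    refine Measure.ext_of_Ici _ _ fun t => ?_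
    have hτ0 : 0 ≤ max 0 (min t R) := le_max_left _ _
    have hτR : max 0 (min t R) ≤ R := max_le hR.le (min_le_right _ _)
    have hmem : ∀ s, 0 < s → s < R → (t ≤ s ↔ ¬ s < max 0 (min t R)) := fun s h0 hs => by
      simp [not_lt, h0.le, hs.not_ge]
    set τ := max 0 (min t R)
    have h1 : lastCoord n ⁻¹' Ici t ∩ cone n R 0 = cone n R 0 \ cone n τ 0 := by
      ext y
      simp only [mem_inter_iff, mem_preimage, mem_Ici, mem_sdiff, and_comm (a := t ≤ _)]
      refine and_congr_right fun hy => ?_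
      rw [hmem _ (lastCoord_pos_of_mem_cone hy) (mem_cone_zero.1 hy).2, mem_cone_zero,
        and_iff_right (mem_cone_zero.1 hy).1]
    have h2 : Ici t ∩ Ioo 0 R = Ioo 0 R \ Ioo 0 τ := by
      ext s
      simp only [mem_inter_iff, mem_Ici, mem_sdiff, and_comm (a := t ≤ _)]
      refine and_congr_right fun hs => ?_
      rw [hmem _ hs.1 hs.2, mem_Ioo, and_iff_right hs.1]
    have h3 : cone n τ 0 ⊆ cone n R 0 := fun y hy =>
      mem_cone_zero.2 ⟨(mem_cone_zero.1 hy).1, (mem_cone_zero.1 hy).2.trans_le hτR⟩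
    have hI : ∀ r, 0 ≤ r → ∫⁻ s in Ioo 0 r, A * ENNReal.ofReal (n * s ^ (n - 1)) =
        volume (cone n r 0) := fun r hr => by
      rw [lintegral_const_mul _ (by fun_prop), lintegral_Ioo_pow hn hr, volume_cone hn hr,
        mul_comm]
    rw [Measure.map_apply measurable_lastCoord measurableSet_Ici,
      Measure.restrict_apply (measurable_lastCoord measurableSet_Ici), h1,
      measure_sdiff h3 (isOpen_cone _ _).measurableSet.nullMeasurableSet (volume_cone_ne_top hn τ),
      withDensity_apply _ measurableSet_Ici, Measure.restrict_restrict measurableSet_Ici, h2,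
      ← hI R hR.le, ← hI τ hτ0]
    refine (ENNReal.eq_sub_of_add_eq ?_ ?_).symm
    · rw [hI τ hτ0]
      exact volume_cone_ne_top hn τ
    · rw [add_comm, ← lintegral_union (measurableSet_Ioo.diff measurableSet_Ioo)
        disjoint_sdiff_self_right,
        union_sdiff_cancel (Ioo_subset_Ioo_right hτR)]
  rw [← lintegral_map hF measurable_lastCoord, key,
    lintegral_withDensity_eq_lintegral_mul _ hd hF, ← lintegral_const_mul _ (by fun_prop)]
  simp [mul_assoc]

lemma enorm_sub_le_lintegral_fderiv_segment {u : EuclideanSpace ℝ (Fin n) → ℝ}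
    (hu : ContDiffOn ℝ 1 u (upperHalf n)) {x y : EuclideanSpace ℝ (Fin n)}
    (hx : 0 < lastCoord n x) (hy : 0 < lastCoord n y) :
    ‖u x - u (x + y)‖ₑ ≤ ∫⁻ t in Ioo (0 : ℝ) 1, ‖fderiv ℝ u (x + t • y)‖ₑ * ‖y‖ₑ := by
  have hmem : ∀ t ∈ Icc (0 : ℝ) 1, x + t • y ∈ upperHalf n := fun t ht => by
    have := mul_nonneg ht.1 hy.le
    simp only [upperHalf, mem_ofPred_eq, lastCoord_add, lastCoord_smul]
    positivity
  have hline : ContDiff ℝ 1 fun t : ℝ => x + t • y := by fun_prop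
  have h := enorm_sub_le_lintegral_deriv_of_contDiffOn_Icc
    (hu.comp hline.contDiffOn hmem) zero_le_one
  simp only [Function.comp_apply, one_smul, zero_smul, add_zero] at h
  rw [enorm_sub_rev]
  refine h.trans ?_
  rw [setLIntegral_congr Ioo_ae_eq_Icc.symm]
  refine setLIntegral_mono' measurableSet_Ioo fun t ht => ?_
  have hd : DifferentiableAt ℝ u (x + t • y) :=
    (hu.differentiableOn one_ne_zero).differentiableAt
      (isOpen_upperHalf.mem_nhds (hmem t (Ioo_subset_Icc_self ht)))
  have hl : HasDerivAt (fun t : ℝ => x + t • y) y t := by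
    simpa using ((hasDerivAt_id t).smul_const y).const_add x
  rw [(hd.hasFDerivAt.comp_hasDerivAt t hl).deriv]
  exact (fderiv ℝ u (x + t • y)).le_opENorm y

lemma setLIntegral_Ioi_rpow (hn : 1 ≤ n) {c : ℝ} (hc : 0 < c) :
    ∫⁻ t in Ioi c, ENNReal.ofReal ((t ^ (n + 1))⁻¹) = ENNReal.ofReal ((n * c ^ n)⁻¹) := by
  have hn' : (0 : ℝ) < n := by positivity
  have hlt : -((n : ℝ) + 1) < -1 := by linarith
  have hcongr : ∀ t ∈ Ioi c, ENNReal.ofReal ((t ^ (n + 1))⁻¹) =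
      ENNReal.ofReal (t ^ (-((n : ℝ) + 1))) := fun t ht => by
    rw [Real.rpow_neg (hc.trans ht).le]
    norm_cast
  rw [setLIntegral_congr_fun measurableSet_Ioi hcongr,
    ← ofReal_integral_eq_lintegral_ofReal (integrableOn_Ioi_rpow_of_lt hlt hc),
    integral_Ioi_rpow_of_lt hlt hc]
  · congr 1
    rw [show -((n : ℝ) + 1) + 1 = -n by ring, Real.rpow_neg hc.le, Real.rpow_natCast]
    field_simp
  · filter_upwards [self_mem_ae_restrict measurableSet_Ioi] with t ht
    exact Real.rpow_nonneg (hc.trans ht).le _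

lemma setLIntegral_cone_smul_eq_ite {G : EuclideanSpace ℝ (Fin n) → ℝ≥0∞} {R t : ℝ}
    (hR : 0 < R) (ht : t ∈ Ioo (0 : ℝ) 1) :
    ∫⁻ y in cone n R 0, G (t • y) * ‖y‖ₑ =
      ∫⁻ w in cone n R 0, G w * ‖w‖ₑ *
        (if lastCoord n w < t * R then ENNReal.ofReal ((t ^ (n + 1))⁻¹) else 0) := by
  have ht0 := ht.1
  have h1 : ∀ y : EuclideanSpace ℝ (Fin n), G (t • y) * ‖y‖ₑ =
      (fun w => ENNReal.ofReal t⁻¹ * (G w * ‖w‖ₑ)) (t • y) := fun y => by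
    have : ‖t • y‖ₑ = ENNReal.ofReal t * ‖y‖ₑ := by
      rw [enorm_smul, Real.enorm_of_nonneg ht0.le]
    simp only [this]
    calc G (t • y) * ‖y‖ₑ = ENNReal.ofReal (t⁻¹ * t) * (G (t • y) * ‖y‖ₑ) := by
          rw [inv_mul_cancel₀ ht0.ne', ENNReal.ofReal_one, one_mul]
      _ = _ := by rw [ENNReal.ofReal_mul (by positivity)]; ring
  have h2 : cone n (t * R) 0 = {w | lastCoord n w < t * R} ∩ cone n R 0 := by
    ext w
    have : t * R < R := by nlinarith [ht.2]
    simp only [mem_inter_iff, mem_cone_zero, mem_ofPred_eq]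
    constructor
    · rintro ⟨ha, hb⟩
      exact ⟨hb, ha, hb.trans this⟩
    · rintro ⟨hb, ha, -⟩
      exact ⟨ha, hb⟩
  have hmeas : MeasurableSet {w : EuclideanSpace ℝ (Fin n) | lastCoord n w < t * R} :=
    measurableSet_lt measurable_lastCoord measurable_const
  simp_rw [h1]
  rw [setLIntegral_cone_comp_smul ht0 fun w => ENNReal.ofReal t⁻¹ * (G w * ‖w‖ₑ),
    ← lintegral_const_mul' _ _ ENNReal.ofReal_ne_top, h2,
    ← Measure.restrict_restrict hmeas, ← lintegral_indicator hmeas]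
  refine lintegral_congr fun w => ?_
  simp only [indicator_apply, mem_ofPred_eq]
  split_ifs
  · rw [← mul_assoc, ← ENNReal.ofReal_mul (by positivity), mul_comm, pow_succ, mul_inv]
  · simp

/-- Averaging over a cone the integrals along the segments issued from its vertex is controlled
by the Riesz-type potential with kernel `wₙ ^ (1 - n)`. -/
lemma setLIntegral_cone_segment_le (hn : 1 ≤ n) {G : EuclideanSpace ℝ (Fin n) → ℝ≥0∞}
    (hG : Measurable G) {R : ℝ} (hR : 0 < R) :
    ∫⁻ y in cone n R 0, ∫⁻ t in Ioo (0 : ℝ) 1, G (t • y) * ‖y‖ₑ ≤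
      ENNReal.ofReal (2 * R ^ n / n) *
        ∫⁻ w in cone n R 0, G w * ENNReal.ofReal ((lastCoord n w ^ (n - 1))⁻¹) := by
  rw [lintegral_lintegral_swap (by fun_prop),
    setLIntegral_congr_fun measurableSet_Ioo fun t ht => setLIntegral_cone_smul_eq_ite hR ht,
    lintegral_lintegral_swap, ← lintegral_const_mul' _ _ ENNReal.ofReal_ne_top]
  · refine setLIntegral_mono' (isOpen_cone R 0).measurableSet fun w hw => ?_
    have hw0 := lastCoord_pos_of_mem_cone hw
    have hn' : (0 : ℝ) < n := by positivity
    have hinner : ∫⁻ t in Ioo (0 : ℝ) 1,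
        (if lastCoord n w < t * R then ENNReal.ofReal ((t ^ (n + 1))⁻¹) else 0) ≤
        ENNReal.ofReal ((n * (lastCoord n w / R) ^ n)⁻¹) := by
      rw [← setLIntegral_Ioi_rpow hn (div_pos hw0 hR), ← lintegral_indicator measurableSet_Ioi]
      refine (setLIntegral_le_lintegral _ _).trans (lintegral_mono fun t => ?_)
      simp only [indicator_apply, mem_Ioi, div_lt_iff₀ hR, le_refl]
    have hnorm : ‖w‖ₑ ≤ ENNReal.ofReal (2 * lastCoord n w) := by
      rw [← ofReal_norm]
      exact ENNReal.ofReal_le_ofReal (norm_le_of_mem_cone hn hw)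
    rw [lintegral_const_mul _ (by
      refine Measurable.ite (measurableSet_lt ?_ ?_) ?_ ?_ <;> fun_prop)]
    calc _ ≤ G w * ENNReal.ofReal (2 * lastCoord n w) *
          ENNReal.ofReal ((n * (lastCoord n w / R) ^ n)⁻¹) := by gcongr
      _ = G w * ENNReal.ofReal (2 * R ^ n / n * (lastCoord n w ^ (n - 1))⁻¹) := by
          rw [mul_assoc, ← ENNReal.ofReal_mul (by positivity)]
          congr 2
          obtain ⟨m, rfl⟩ : ∃ m, n = m + 1 := ⟨n - 1, by omega⟩
          simp only [Nat.add_sub_cancel, div_pow, pow_succ]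
          field_simp
      _ = _ := by rw [ENNReal.ofReal_mul (by positivity)]; ring
  · refine Measurable.aemeasurable ?_
    refine Measurable.mul (by fun_prop) ?_
    refine Measurable.ite (measurableSet_lt ?_ ?_) ?_ ?_ <;> fun_prop

lemma setLIntegral_Ioo_rpow_le_log {α a R : ℝ} (hα : 0 < α) (ha : 0 < a) (hR : 0 < R) :
    ∫⁻ s in Ioo 0 R, ENNReal.ofReal (s ^ (α - 1) * (a + s) ^ (-α)) ≤
      ENNReal.ofReal (2 / α * Real.log (1 + (R / a) ^ α)) := by
  have haα : 0 < a ^ α := Real.rpow_pos_of_pos ha α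
  have hcont : ContinuousOn (fun s : ℝ => 2 / α * Real.log (a ^ α + s ^ α)) (Icc 0 R) := by
    refine continuousOn_const.mul (ContinuousOn.log ?_ fun s hs => ?_)
    · exact continuousOn_const.add (continuousOn_id.rpow_const fun s _ => Or.inr hα.le)
    · have := Real.rpow_nonneg hs.1 α
      positivity
  have hderiv : ∀ s ∈ Ioo 0 R, HasDerivAt (fun s : ℝ => 2 / α * Real.log (a ^ α + s ^ α))
      (2 * s ^ (α - 1) / (a ^ α + s ^ α)) s := fun s hs => by
    have hsα : 0 < s ^ α := Real.rpow_pos_of_pos hs.1 α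
    refine ((((Real.hasDerivAt_rpow_const (p := α) (Or.inl hs.1.ne')).const_add (a ^ α)).log
      (by positivity)).const_mul (2 / α)).congr_deriv ?_
    field_simp
  have hpos : ∀ s ∈ Ioo 0 R, 0 ≤ 2 * s ^ (α - 1) / (a ^ α + s ^ α) := fun s hs => by
    have := hs.1
    positivity
  have hint := intervalIntegral.integrableOn_deriv_of_nonneg hcont hderiv hpos
  have hval : ∫ s in (0 : ℝ)..R, 2 * s ^ (α - 1) / (a ^ α + s ^ α) =
      2 / α * Real.log (1 + (R / a) ^ α) := by
    rw [intervalIntegral.integral_eq_sub_of_hasDerivAt_of_le hR.le hcont hderiv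
      ((intervalIntegrable_iff_integrableOn_Ioc_of_le hR.le).2 hint), ← mul_sub,
      Real.zero_rpow hα.ne', add_zero, ← Real.log_div (by positivity) haα.ne',
      Real.div_rpow hR.le ha.le, add_div, div_self haα.ne']
  rw [← hval, intervalIntegral.integral_of_le hR.le, integral_Ioc_eq_integral_Ioo,
    ofReal_integral_eq_lintegral_ofReal (hint.mono_set Ioo_subset_Ioc_self)
      ((ae_restrict_iff' measurableSet_Ioo).2 (.of_forall hpos))]
  refine setLIntegral_mono' measurableSet_Ioo fun s hs => ENNReal.ofReal_le_ofReal ?_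
  have hs0 := hs.1
  have h1 : a ^ α ≤ (a + s) ^ α := Real.rpow_le_rpow ha.le (by linarith) hα.le
  have h2 : s ^ α ≤ (a + s) ^ α := Real.rpow_le_rpow hs0.le (by linarith) hα.le
  rw [Real.rpow_neg (by positivity), ← div_eq_mul_inv, div_le_div_iff₀ (by positivity)
    (by positivity)]
  nlinarith [Real.rpow_pos_of_pos hs0 (α - 1)]

lemma lintegral_cone_kernel_rpow_le (hn : 1 ≤ n) {p a R : ℝ} (hnp : (n : ℝ) < p) (ha : 0 < a)
    (hR : 0 < R) :
    ∫⁻ w in cone n R 0, ENNReal.ofReal ((lastCoord n w ^ (n - 1))⁻¹ *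
        (a + lastCoord n w) ^ (-((p - n) / p))) ^ (p / (p - 1)) ≤
      volume (cone n 1 0) * ENNReal.ofReal
        (n * (2 / ((p - n) / (p - 1)) * Real.log (1 + (R / a) ^ ((p - n) / (p - 1))))) := by
  have hn1 : (1 : ℝ) ≤ n := by exact_mod_cast hn
  have hp1 : 0 < p - 1 := by linarith
  have hp0 : 0 < p := by linarith
  have hα : 0 < (p - n) / (p - 1) := div_pos (by linarith) hp1
  rw [setLIntegral_cone_lastCoord hn hR
    (F := fun s => ENNReal.ofReal ((s ^ (n - 1))⁻¹ * (a + s) ^ (-((p - n) / p))) ^ (p / (p - 1)))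
    (by fun_prop)]
  gcongr
  rw [ENNReal.ofReal_mul (by positivity)]
  refine le_trans ?_ (mul_le_mul_right (setLIntegral_Ioo_rpow_le_log hα ha hR) _)
  rw [← lintegral_const_mul' _ _ ENNReal.ofReal_ne_top]
  refine (setLIntegral_congr_fun measurableSet_Ioo fun s hs => ?_).le
  have hs0 := hs.1
  have has : 0 < a + s := by linarith
  rw [ENNReal.ofReal_rpow_of_nonneg (by positivity) (by positivity),
    ← ENNReal.ofReal_mul (by positivity), ← ENNReal.ofReal_mul (by positivity)]
  congr 1
  rw [Real.mul_rpow (by positivity) (by positivity), ← Real.rpow_mul has.le,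
    show -((p - n) / p) * (p / (p - 1)) = -((p - n) / (p - 1)) by field_simp, mul_assoc,
    ← mul_assoc (s ^ (n - 1))]
  congr 2
  rw [← Real.rpow_natCast, ← Real.rpow_neg hs0.le, ← Real.rpow_mul hs0.le,
    ← Real.rpow_add hs0, Nat.cast_sub hn]
  congr 1
  field_simp
  push_cast
  ring

lemma setLIntegral_cone_potential_le (hn : 1 ≤ n) {p a R : ℝ} (hnp : (n : ℝ) < p) (ha : 0 < a)
    (hR : 0 < R) {G : EuclideanSpace ℝ (Fin n) → ℝ} (hG : Measurable G) (hG0 : ∀ w, 0 ≤ G w) :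
    ∫⁻ w in cone n R 0, ENNReal.ofReal (G w) * ENNReal.ofReal ((lastCoord n w ^ (n - 1))⁻¹) ≤
      (∫⁻ w in cone n R 0, ENNReal.ofReal (G w ^ p * (a + lastCoord n w) ^ (p - n))) ^ (1 / p) *
      (volume (cone n 1 0) * ENNReal.ofReal (n * (2 / ((p - n) / (p - 1)) *
        Real.log (1 + (R / a) ^ ((p - n) / (p - 1)))))) ^ (1 - 1 / p) := by
  have hn1 : (1 : ℝ) ≤ n := by exact_mod_cast hn
  have hp0 : 0 < p := by linarith
  have hp1 : 0 < p - 1 := by linarith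
  have hpq : p.HolderConjugate (p / (p - 1)) :=
    Real.HolderConjugate.conjExponent (by linarith)
  have hq : 1 / (p / (p - 1)) = 1 - 1 / p := by field_simp
  have hq0 : 0 ≤ 1 - 1 / p := hq ▸ by positivity
  set F₁ : EuclideanSpace ℝ (Fin n) → ℝ≥0∞ :=
    fun w => ENNReal.ofReal (G w * (a + lastCoord n w) ^ ((p - n) / p)) with hF₁
  set F₂ : EuclideanSpace ℝ (Fin n) → ℝ≥0∞ := fun w =>
    ENNReal.ofReal ((lastCoord n w ^ (n - 1))⁻¹ * (a + lastCoord n w) ^ (-((p - n) / p))) with hF₂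
  calc _ = ∫⁻ w in cone n R 0, (F₁ * F₂) w := by
        refine setLIntegral_congr_fun (isOpen_cone R 0).measurableSet fun w hw => ?_
        have hw0 := lastCoord_pos_of_mem_cone hw
        have haw : 0 < a + lastCoord n w := by linarith
        have hGw := hG0 w
        rw [Pi.mul_apply, ← ENNReal.ofReal_mul hGw, hF₁, hF₂,
          ← ENNReal.ofReal_mul (by positivity), Real.rpow_neg haw.le]
        congr 1
        field_simp
    _ ≤ (∫⁻ w in cone n R 0, F₁ w ^ p) ^ (1 / p) *
          (∫⁻ w in cone n R 0, F₂ w ^ (p / (p - 1))) ^ (1 / (p / (p - 1))) :=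
        ENNReal.lintegral_mul_le_Lp_mul_Lq _ hpq (by fun_prop) (by fun_prop)
    _ ≤ _ := by
        rw [hq]
        gcongr ?_ ^ (1 / p) * ?_ ^ (1 - 1 / p)
        · refine (setLIntegral_congr_fun (isOpen_cone R 0).measurableSet fun w hw => ?_).le
          have hw0 := lastCoord_pos_of_mem_cone hw
          have haw : 0 < a + lastCoord n w := by linarith
          have hGw := hG0 w
          rw [hF₁, ENNReal.ofReal_rpow_of_nonneg (by positivity) hp0.le,
            Real.mul_rpow hGw (by positivity), ← Real.rpow_mul haw.le,
            div_mul_cancel₀ _ hp0.ne']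
        · exact lintegral_cone_kernel_rpow_le hn hnp ha hR

/-- Estimate on cone averages, case `γ = p - n`. -/
theorem cone_average_estimate_eq (n : ℕ) (hn : 1 ≤ n) (p : ℝ) (hnp : (n : ℝ) < p) :
    ∃ C : ℝ, 0 < C ∧
      ∀ u : EuclideanSpace ℝ (Fin n) → ℝ,
        ContDiffOn ℝ 1 u (upperHalf n) →
        ∀ x ∈ upperHalf n, ∀ R > (0 : ℝ),
          (volume (cone n R x))⁻¹ * (∫⁻ z in cone n R x, ENNReal.ofReal |u x - u z|) ≤
            ENNReal.ofReal
                (C * (Real.log (1 + (R / lastCoord n x) ^ ((p - n) / (p - 1)))) ^ (1 - 1 / p)) *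
              (∫⁻ z in cone n R x,
                  ENNReal.ofReal (‖fderiv ℝ u z‖ ^ p * lastCoord n z ^ (p - n))) ^ (1 / p) := by
  have hn1 : (1 : ℝ) ≤ n := by exact_mod_cast hn
  have hp1 : 0 < p - 1 := by linarith
  have hp0 : 0 < p := by linarith
  have hpn : 0 < p - n := by linarith
  have hq0 : 0 ≤ 1 - 1 / p := by
    rw [sub_nonneg, div_le_one hp0]
    linarith
  obtain ⟨A, hA0, hA⟩ : ∃ A : ℝ, 0 < A ∧ volume (cone n 1 0) = ENNReal.ofReal A :=
    ⟨(volume (cone n 1 0)).toReal,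
      ENNReal.toReal_pos (volume_cone_ne_zero hn one_pos) (volume_cone_ne_top hn 1),
      (ENNReal.ofReal_toReal (volume_cone_ne_top hn 1)).symm⟩
  refine ⟨2 / (n * A) * (A * (n * (2 / ((p - n) / (p - 1))))) ^ (1 - 1 / p), by positivity,
    fun u hu x hx R hR => ?_⟩
  have hx0 : 0 < lastCoord n x := hx
  set L := Real.log (1 + (R / lastCoord n x) ^ ((p - n) / (p - 1)))
  have hL : 0 ≤ L := Real.log_nonneg (by
    have : 0 ≤ (R / lastCoord n x) ^ ((p - n) / (p - 1)) := by positivity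
    linarith)
  have hG : Measurable fun w => ‖fderiv ℝ u (x + w)‖ :=
    ((measurable_fderiv ℝ u).comp (measurable_const_add x)).norm
  set E := ∫⁻ z in cone n R x, ENNReal.ofReal (‖fderiv ℝ u z‖ ^ p * lastCoord n z ^ (p - n)) with hE
  rw [setLIntegral_cone_eq] at hE
  simp only [lastCoord_add] at hE
  rw [setLIntegral_cone_eq, volume_cone_eq, volume_cone hn hR.le, hA,
    ← ENNReal.ofReal_mul (by positivity), ← ENNReal.ofReal_inv_of_pos (by positivity)]
  calc _ ≤ ENNReal.ofReal (R ^ n * A)⁻¹ * (ENNReal.ofReal (2 * R ^ n / n) *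
        (E ^ (1 / p) * (ENNReal.ofReal A *
          ENNReal.ofReal (n * (2 / ((p - n) / (p - 1)) * L))) ^ (1 - 1 / p))) := by
        gcongr
        calc _ ≤ ∫⁻ y in cone n R 0, ∫⁻ t in Ioo (0 : ℝ) 1,
              ENNReal.ofReal ‖fderiv ℝ u (x + t • y)‖ * ‖y‖ₑ := by
              refine setLIntegral_mono' (isOpen_cone R 0).measurableSet fun y hy => ?_
              rw [← Real.norm_eq_abs, ofReal_norm]
              simp_rw [ofReal_norm]
              exact enorm_sub_le_lintegral_fderiv_segment hu hx0 (lastCoord_pos_of_mem_cone hy)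
          _ ≤ _ := setLIntegral_cone_segment_le hn hG.ennreal_ofReal hR
          _ ≤ _ := by
              gcongr
              rw [hE, ← hA]
              exact setLIntegral_cone_potential_le hn hnp hx0 hR hG fun w => norm_nonneg _
    _ = _ := by
        rw [← ENNReal.ofReal_mul hA0.le, ENNReal.ofReal_rpow_of_nonneg (by positivity) hq0,
          ← mul_assoc, ← ENNReal.ofReal_mul (by positivity), mul_left_comm,
          ← ENNReal.ofReal_mul (by positivity), mul_comm]
        congr 2
        rw [show A * (n * (2 / ((p - n) / (p - 1)) * L)) =
          A * (n * (2 / ((p - n) / (p - 1)))) * L by ring, Real.mul_rpow (by positivity) hL]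
        field_simp
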